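/- Let h, f, b : ℂ → ℂ be entire holomorphic functions, define a := e^{2Re(h)}, and suppose c : ℂ → ℂ and d : ℂ → ℝ are smooth functions satisfying c_w̄ = a·conj(f) and d_{w̄w} = a|f|² + 1/a on ℂ. Then u(z,w) = a(w)|z|² + b(w)z² + conj(b(w)z²) + c(w)z + conj(c(w)z) + d(w) is a smooth strictly plurisubharmonic function on ℂ² satisfying det(∂∂̄u) = 1 everywhere on ℂ². -/

import Mathlib

open Complex
open scoped ComplexOrder

noncomputable section

/-- Wirtinger derivative `F_w = (1/2)(∂F/∂x − i ∂F/∂y)`. -/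
def wDeriv (F : ℂ → ℂ) (w : ℂ) : ℂ :=
  (fderiv ℝ F w 1 - Complex.I * fderiv ℝ F w Complex.I) / 2

/-- Wirtinger derivative `F_w̄ = (1/2)(∂F/∂x + i ∂F/∂y)`. -/
def wBarDeriv (F : ℂ → ℂ) (w : ℂ) : ℂ :=
  (fderiv ℝ F w 1 + Complex.I * fderiv ℝ F w Complex.I) / 2

/-- The mixed second Wirtinger derivative `F_{w̄ w}`. -/
def wBarWDeriv (F : ℂ → ℂ) (w : ℂ) : ℂ := wDeriv (wBarDeriv F) w

/-- `u_z`, the Wirtinger derivative in the first variable. -/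
def pzDeriv (u : ℂ × ℂ → ℂ) (p : ℂ × ℂ) : ℂ :=
  (fderiv ℝ u p (1, 0) - Complex.I * fderiv ℝ u p (Complex.I, 0)) / 2

/-- `u_z̄`, the conjugate Wirtinger derivative in the first variable. -/
def pzBarDeriv (u : ℂ × ℂ → ℂ) (p : ℂ × ℂ) : ℂ :=
  (fderiv ℝ u p (1, 0) + Complex.I * fderiv ℝ u p (Complex.I, 0)) / 2

/-- `u_w`, the Wirtinger derivative in the second variable. -/
def pwDeriv (u : ℂ × ℂ → ℂ) (p : ℂ × ℂ) : ℂ :=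
  (fderiv ℝ u p (0, 1) - Complex.I * fderiv ℝ u p (0, Complex.I)) / 2

/-- `u_w̄`, the conjugate Wirtinger derivative in the second variable. -/
def pwBarDeriv (u : ℂ × ℂ → ℂ) (p : ℂ × ℂ) : ℂ :=
  (fderiv ℝ u p (0, 1) + Complex.I * fderiv ℝ u p (0, Complex.I)) / 2

/-- The complex Hessian `[[u_{z z̄}, u_{z w̄}], [u_{w z̄}, u_{w w̄}]]` of a real-valued
function on `ℂ × ℂ`. -/
def complexHessian (u : ℂ × ℂ → ℝ) (p : ℂ × ℂ) : Matrix (Fin 2) (Fin 2) ℂ :=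
  !![pzDeriv (pzBarDeriv fun q => (u q : ℂ)) p, pzDeriv (pwBarDeriv fun q => (u q : ℂ)) p;
     pwDeriv (pzBarDeriv fun q => (u q : ℂ)) p, pwDeriv (pwBarDeriv fun q => (u q : ℂ)) p]

/-- `det (∂ ∂̄ u) = u_{z z̄} u_{w w̄} − u_{z w̄} u_{w z̄}`. -/
def MAdet (u : ℂ × ℂ → ℝ) (p : ℂ × ℂ) : ℂ := (complexHessian u p).det

/-- `u` is strictly plurisubharmonic at `p` iff its complex Hessian is positive definite. -/
def StrictPSHAt (u : ℂ × ℂ → ℝ) (p : ℂ × ℂ) : Prop := (complexHessian u p).PosDef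

/-- The special quadric form (smae):
`u(z,w) = a(w)|z|² + b(w)z² + conj(b(w)z²) + c(w)z + conj(c(w)z) + d(w)`. -/
def smae (a d : ℂ → ℝ) (b c : ℂ → ℂ) : ℂ × ℂ → ℝ := fun p =>
  a p.2 * Complex.normSq p.1 + (b p.2 * p.1 ^ 2 + (starRingEnd ℂ) (b p.2 * p.1 ^ 2)
    + c p.2 * p.1 + (starRingEnd ℂ) (c p.2 * p.1)).re + d p.2

/-- The system (ma0) on a set `D ⊆ ℂ`:
`a a_{w̄w} = |a_w|² + 4|b_w̄|²`, `a b_{w̄w} = 2 a_w b_w̄`,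
`a c_{w̄w} = a_w c_w̄ + 2 b_w̄ conj(c_w)`, `a d_{w̄w} = |c_w̄|² + 1`. -/
def ma0sys (a d : ℂ → ℝ) (b c : ℂ → ℂ) (D : Set ℂ) : Prop :=
  ∀ w ∈ D,
    (a w : ℂ) * wBarWDeriv (fun v => (a v : ℂ)) w
        = (Complex.normSq (wDeriv (fun v => (a v : ℂ)) w) : ℂ)
          + 4 * (Complex.normSq (wBarDeriv b w) : ℂ) ∧
    (a w : ℂ) * wBarWDeriv b w = 2 * wDeriv (fun v => (a v : ℂ)) w * wBarDeriv b w ∧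
    (a w : ℂ) * wBarWDeriv c w
        = wDeriv (fun v => (a v : ℂ)) w * wBarDeriv c w
          + 2 * wBarDeriv b w * (starRingEnd ℂ) (wDeriv c w) ∧
    (a w : ℂ) * wBarWDeriv (fun v => (d v : ℂ)) w = (Complex.normSq (wBarDeriv c w) : ℂ) + 1


def WL (A B C D : ℂ) : ℂ × ℂ →L[ℝ] ℂ :=
  A • ContinuousLinearMap.fst ℝ ℂ ℂ
  + B • ((Complex.conjCLE : ℂ →L[ℝ] ℂ).comp (ContinuousLinearMap.fst ℝ ℂ ℂ))
  + C • ContinuousLinearMap.snd ℝ ℂ ℂ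
  + D • ((Complex.conjCLE : ℂ →L[ℝ] ℂ).comp (ContinuousLinearMap.snd ℝ ℂ ℂ))

theorem WL_apply (A B C D : ℂ) (v : ℂ × ℂ) : WL A B C D v =
    A * v.1 + B * (starRingEnd ℂ) v.1 + C * v.2 + D * (starRingEnd ℂ) v.2 := by
  simp [WL]

def WO (A B : ℂ) : ℂ →L[ℝ] ℂ :=
  A • ContinuousLinearMap.id ℝ ℂ + B • (Complex.conjCLE : ℂ →L[ℝ] ℂ)

theorem WO_apply (A B v : ℂ) : WO A B v = A * v + B * (starRingEnd ℂ) v := by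
  simp [WO]

def HW (u : ℂ × ℂ → ℂ) (A B C D : ℂ) (p : ℂ × ℂ) : Prop := HasFDerivAt u (WL A B C D) p

theorem HW.congr {u A B C D p A' B' C' D'} (h : HW u A B C D p) (hA : A = A') (hB : B = B')
    (hC : C = C') (hD : D = D') : HW u A' B' C' D' p := by
  subst hA hB hC hD; exact h

theorem HW.pz {u A B C D p} (h : HW u A B C D p) : pzDeriv u p = A := by
  unfold pzDeriv
  rw [HasFDerivAt.fderiv h, WL_apply, WL_apply]
  simp
  linear_combination (-A / 2 + B / 2) * Complex.I_mul_I

theorem HW.pzb {u A B C D p} (h : HW u A B C D p) : pzBarDeriv u p = B := by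
  unfold pzBarDeriv
  rw [HasFDerivAt.fderiv h, WL_apply, WL_apply]
  simp
  linear_combination (A / 2 - B / 2) * Complex.I_mul_I

theorem HW.pw {u A B C D p} (h : HW u A B C D p) : pwDeriv u p = C := by
  unfold pwDeriv
  rw [HasFDerivAt.fderiv h, WL_apply, WL_apply]
  simp
  linear_combination (-C / 2 + D / 2) * Complex.I_mul_I

theorem HW.pwb {u A B C D p} (h : HW u A B C D p) : pwBarDeriv u p = D := by
  unfold pwBarDeriv
  rw [HasFDerivAt.fderiv h, WL_apply, WL_apply]
  simp
  linear_combination (C / 2 - D / 2) * Complex.I_mul_I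

theorem HW.add {u v A B C D A' B' C' D' p} (h : HW u A B C D p) (h' : HW v A' B' C' D' p) :
    HW (fun q => u q + v q) (A + A') (B + B') (C + C') (D + D') p := by
  refine (HasFDerivAt.add h h').congr_fderiv ?_
  refine ContinuousLinearMap.ext fun x => ?_
  simp only [_root_.add_apply, WL_apply]
  ring

theorem HW.mul {u v A B C D A' B' C' D' p} (h : HW u A B C D p) (h' : HW v A' B' C' D' p) :
    HW (fun q => u q * v q) (u p * A' + v p * A) (u p * B' + v p * B)
      (u p * C' + v p * C) (u p * D' + v p * D) p := by
  refine (HasFDerivAt.mul h h').congr_fderiv ?_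
  refine ContinuousLinearMap.ext fun x => ?_
  simp only [_root_.add_apply, _root_.smul_apply, WL_apply, smul_eq_mul]
  ring

theorem HW.conj {u A B C D p} (h : HW u A B C D p) :
    HW (fun q => (starRingEnd ℂ) (u q)) ((starRingEnd ℂ) B) ((starRingEnd ℂ) A)
      ((starRingEnd ℂ) D) ((starRingEnd ℂ) C) p := by
  refine ((Complex.conjCLE : ℂ →L[ℝ] ℂ).hasFDerivAt.comp p h).congr_fderiv ?_
  refine ContinuousLinearMap.ext fun x => ?_
  simp [WL_apply]
  ring

theorem HW.fst (p : ℂ × ℂ) : HW (fun q => q.1) 1 0 0 0 p := by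
  refine (hasFDerivAt_fst (𝕜 := ℝ)).congr_fderiv ?_
  refine ContinuousLinearMap.ext fun x => ?_
  simp [WL_apply]

theorem HW.const (k : ℂ) (p : ℂ × ℂ) : HW (fun _ => k) 0 0 0 0 p := by
  refine (hasFDerivAt_const (𝕜 := ℝ) k p).congr_fderiv ?_
  refine ContinuousLinearMap.ext fun x => ?_
  simp [WL_apply]

theorem HW.lift {F : ℂ → ℂ} (p : ℂ × ℂ) (h : DifferentiableAt ℝ F p.2) :
    HW (fun q => F q.2) 0 0 (wDeriv F p.2) (wBarDeriv F p.2) p := by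
  refine (h.hasFDerivAt.comp p (hasFDerivAt_snd (𝕜 := ℝ))).congr_fderiv ?_
  refine ContinuousLinearMap.ext fun x => ?_
  simp only [WL_apply, wDeriv, wBarDeriv, ContinuousLinearMap.comp_apply,
    ContinuousLinearMap.coe_snd']
  generalize fderiv ℝ F p.2 = L
  have hx : L x.2 = x.2.re * L 1 + x.2.im * L Complex.I := by
    conv_lhs => rw [show x.2 = x.2.re • (1 : ℂ) + x.2.im • Complex.I by simp]
    rw [map_add, map_smul, map_smul]; simp
  rw [hx]
  have h1 : (starRingEnd ℂ) x.2 = x.2.re - x.2.im * Complex.I := by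
    apply Complex.ext <;> simp
  rw [h1]
  have h2 : x.2 = x.2.re + x.2.im * Complex.I := (Complex.re_add_im x.2).symm
  linear_combination (x.2.im * L Complex.I) * Complex.I_mul_I
    - (L 1 - Complex.I * L Complex.I) / 2 * h2

theorem wirt_of_holo {F : ℂ → ℂ} {F' w : ℂ} (h : HasDerivAt F F' w) :
    wDeriv F w = F' ∧ wBarDeriv F w = 0 := by
  have := (h.hasFDerivAt.restrictScalars ℝ).fderiv
  unfold wDeriv wBarDeriv
  rw [this]
  simp
  constructor
  · linear_combination (-F' / 2) * Complex.I_mul_I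
  · linear_combination (F') * Complex.I_mul_I

theorem HW.holo {F : ℂ → ℂ} (p : ℂ × ℂ) (h : Differentiable ℂ F) :
    HW (fun q => F q.2) 0 0 (deriv F p.2) 0 p := by
  have h1 := wirt_of_holo (h p.2).hasDerivAt
  exact (HW.lift p ((h p.2).restrictScalars ℝ)).congr rfl rfl h1.1 h1.2

theorem wDeriv_diff {F : ℂ → ℂ} (h : ContDiff ℝ (⊤ : ℕ∞) F) : Differentiable ℝ (wDeriv F) := by
  have h1 : Differentiable ℝ (fderiv ℝ F) :=
    (h.fderiv_right (m := 1) (by norm_cast)).differentiable (by simp)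
  unfold wDeriv
  fun_prop

theorem wBarDeriv_diff {F : ℂ → ℂ} (h : ContDiff ℝ (⊤ : ℕ∞) F) :
    Differentiable ℝ (wBarDeriv F) := by
  have h1 : Differentiable ℝ (fderiv ℝ F) :=
    (h.fderiv_right (m := 1) (by norm_cast)).differentiable (by simp)
  unfold wBarDeriv
  fun_prop

theorem wirt_symm {F : ℂ → ℂ} (h : ContDiff ℝ (⊤ : ℕ∞) F) (w : ℂ) :
    wBarDeriv (wDeriv F) w = wDeriv (wBarDeriv F) w := by
  have h1 : Differentiable ℝ (fderiv ℝ F) :=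
    (h.fderiv_right (m := 1) (by norm_cast)).differentiable (by simp)
  have hs : IsSymmSndFDerivAt ℝ F w :=
    h.contDiffAt.isSymmSndFDerivAt (by simp; exact WithTop.coe_le_coe.2 (le_top : (2 : ℕ∞) ≤ ⊤))
  have e := hs 1 Complex.I
  have hv : ∀ v : ℂ, HasFDerivAt (fun x => fderiv ℝ F x v)
      ((fderiv ℝ (fderiv ℝ F) w).flip v) w := by
    intro v
    refine ((h1 w).hasFDerivAt.clm_apply (hasFDerivAt_const v w)).congr_fderiv ?_
    refine ContinuousLinearMap.ext fun x => ?_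
    simp
  have hW : fderiv ℝ (wDeriv F) w = (1 / 2 : ℂ) • ((fderiv ℝ (fderiv ℝ F) w).flip 1
      - Complex.I • (fderiv ℝ (fderiv ℝ F) w).flip Complex.I) := by
    refine HasFDerivAt.fderiv ?_
    refine (((hv 1).sub ((hv Complex.I).const_mul Complex.I)).const_mul (1 / 2 : ℂ)).congr_of_eventuallyEq ?_
    refine Filter.Eventually.of_forall fun x => ?_
    simp [wDeriv]; ring
  have hB : fderiv ℝ (wBarDeriv F) w = (1 / 2 : ℂ) • ((fderiv ℝ (fderiv ℝ F) w).flip 1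
      + Complex.I • (fderiv ℝ (fderiv ℝ F) w).flip Complex.I) := by
    refine HasFDerivAt.fderiv ?_
    refine (((hv 1).add ((hv Complex.I).const_mul Complex.I)).const_mul (1 / 2 : ℂ)).congr_of_eventuallyEq ?_
    refine Filter.Eventually.of_forall fun x => ?_
    simp [wBarDeriv]; ring
  unfold wBarDeriv at hB ⊢
  unfold wDeriv at hW ⊢
  rw [hW, hB]
  simp
  rw [e]
  ring

theorem posDef_aux (s g : ℂ) (hs : s ≠ 0) :
    (!![s * (starRingEnd ℂ) s, s * (starRingEnd ℂ) s * (starRingEnd ℂ) g;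
      s * (starRingEnd ℂ) s * g,
      s * (starRingEnd ℂ) s * (g * (starRingEnd ℂ) g) + (s * (starRingEnd ℂ) s)⁻¹] :
      Matrix (Fin 2) (Fin 2) ℂ).PosDef := by
  have hs' : (starRingEnd ℂ) s ≠ 0 := by simpa using hs
  have : (!![s * (starRingEnd ℂ) s, s * (starRingEnd ℂ) s * (starRingEnd ℂ) g;
      s * (starRingEnd ℂ) s * g,
      s * (starRingEnd ℂ) s * (g * (starRingEnd ℂ) g) + (s * (starRingEnd ℂ) s)⁻¹] :
      Matrix (Fin 2) (Fin 2) ℂ) = !![s, 0; s * g, s⁻¹] * (!![s, 0; s * g, s⁻¹]).conjTranspose := by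
    ext i j
    fin_cases i <;> fin_cases j <;>
      simp [Matrix.mul_apply, Fin.sum_univ_two] <;> ring
  rw [this]
  apply Matrix.PosDef.mul_conjTranspose_self
  apply Matrix.vecMul_injective_of_isUnit
  rw [Matrix.isUnit_iff_isUnit_det]
  simp [Matrix.det_fin_two, hs]

/-- for entire holomorphic `h, f, b`, with `a = e^{2Re h}` and `c, d`
smooth solving `c_w̄ = a conj f` and `d_{w̄w} = a|f|² + 1/a`, the function (smae) is an
entire smooth strictly plurisubharmonic solution of `det(∂∂̄u) = 1` on `ℂ²`. -/
theorem stmt5 (h f b : ℂ → ℂ)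
    (hh : Differentiable ℂ h) (hf : Differentiable ℂ f) (hb : Differentiable ℂ b)
    (a : ℂ → ℝ) (ha : a = fun w => Real.exp (2 * (h w).re))
    (c : ℂ → ℂ) (d : ℂ → ℝ)
    (hc : ContDiff ℝ (⊤ : ℕ∞) c) (hd : ContDiff ℝ (⊤ : ℕ∞) d)
    (hceq : ∀ w : ℂ, wBarDeriv c w = (a w : ℂ) * (starRingEnd ℂ) (f w))
    (hdeq : ∀ w : ℂ, wBarWDeriv (fun v => (d v : ℂ)) w
      = ((a w * Complex.normSq (f w) + 1 / a w : ℝ) : ℂ)) :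
    ContDiff ℝ (⊤ : ℕ∞) (smae a d b c) ∧
    ∀ p : ℂ × ℂ, StrictPSHAt (smae a d b c) p ∧ MAdet (smae a d b c) p = 1 := by
  have hE : ∀ w, (a w : ℂ) = Complex.exp (h w) * (starRingEnd ℂ) (Complex.exp (h w)) := by
    intro w
    rw [ha, ← Complex.exp_conj, ← Complex.exp_add, Complex.add_conj]
    push_cast; rfl
  have hapos : ∀ w, (a w : ℂ) ≠ 0 := by
    intro w; rw [ha]; exact_mod_cast (Real.exp_pos _).ne'
  have cdh : ContDiff ℝ (⊤ : ℕ∞) h := (hh.contDiff (n := (⊤ : ℕ∞))).restrict_scalars ℝ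
  have cdb : ContDiff ℝ (⊤ : ℕ∞) b := (hb.contDiff (n := (⊤ : ℕ∞))).restrict_scalars ℝ
  have hh' : Differentiable ℂ (deriv h) := fun w =>
    (hh.analyticAt w).deriv.differentiableAt
  have hb' : Differentiable ℂ (deriv b) := fun w =>
    (hb.analyticAt w).deriv.differentiableAt
  have cdd : ContDiff ℝ (⊤ : ℕ∞) (fun v => (d v : ℂ)) :=
    Complex.ofRealCLM.contDiff.comp hd
  refine ⟨?_, ?_⟩
  · have cda : ContDiff ℝ (⊤ : ℕ∞) a := by
      rw [ha]
      exact (contDiff_const.mul (Complex.reCLM.contDiff.comp cdh)).exp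
    have e : smae a d b c = fun p => a p.2 * (p.1.re * p.1.re + p.1.im * p.1.im)
        + (b p.2 * p.1 ^ 2 + (starRingEnd ℂ) (b p.2 * p.1 ^ 2)
        + c p.2 * p.1 + (starRingEnd ℂ) (c p.2 * p.1)).re + d p.2 := by
      funext p; simp [smae, Complex.normSq_apply]
    rw [e]
    have r1 : ContDiff ℝ (⊤ : ℕ∞) (fun p : ℂ × ℂ => p.1.re) :=
      Complex.reCLM.contDiff.comp contDiff_fst
    have r2 : ContDiff ℝ (⊤ : ℕ∞) (fun p : ℂ × ℂ => p.1.im) :=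
      Complex.imCLM.contDiff.comp contDiff_fst
    have b1 : ContDiff ℝ (⊤ : ℕ∞) (fun p : ℂ × ℂ => b p.2 * p.1 ^ 2) :=
      (cdb.comp contDiff_snd).mul (contDiff_fst.pow 2)
    have c1 : ContDiff ℝ (⊤ : ℕ∞) (fun p : ℂ × ℂ => c p.2 * p.1) :=
      (hc.comp contDiff_snd).mul contDiff_fst
    have cj : ContDiff ℝ (⊤ : ℕ∞) (fun z : ℂ => (starRingEnd ℂ) z) := Complex.conjCLE.contDiff
    have m1 : ContDiff ℝ (⊤ : ℕ∞) (fun p : ℂ × ℂ => b p.2 * p.1 ^ 2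
        + (starRingEnd ℂ) (b p.2 * p.1 ^ 2)
        + c p.2 * p.1 + (starRingEnd ℂ) (c p.2 * p.1)) :=
      ((b1.add (cj.comp b1)).add c1).add (cj.comp c1)
    exact (((cda.comp contDiff_snd).mul ((r1.mul r1).add (r2.mul r2))).add
      (Complex.reCLM.contDiff.comp m1)).add (hd.comp contDiff_snd)
  have hA : ∀ p : ℂ × ℂ, HW (fun q => (a q.2 : ℂ)) 0 0 (a p.2 * deriv h p.2)
      (a p.2 * (starRingEnd ℂ) (deriv h p.2)) p := by
    intro p
    have e1 : HW (fun q => Complex.exp (h q.2)) 0 0 (Complex.exp (h p.2) * deriv h p.2) 0 p := by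
      refine (HW.holo (F := fun w => Complex.exp (h w)) p hh.cexp).congr rfl rfl ?_ rfl
      exact (hh p.2).hasDerivAt.cexp.deriv
    have e2 := e1.mul e1.conj
    simp only [← hE] at e2
    refine e2.congr (by simp) (by simp) ?_ ?_ <;> rw [hE] <;> simp <;> ring
  have hz := HW.fst
  have hzb := fun p => (HW.fst p).conj
  have hu : (fun q => (smae a d b c q : ℂ)) = fun q => (a q.2 : ℂ) * (q.1 * (starRingEnd ℂ) q.1)
      + (b q.2 * (q.1 * q.1) + (starRingEnd ℂ) (b q.2 * (q.1 * q.1))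
      + (c q.2 * q.1 + (starRingEnd ℂ) (c q.2 * q.1))) + (d q.2 : ℂ) := by
    funext q
    apply Complex.ext <;>
      simp [smae, Complex.normSq_apply, pow_two] <;> ring
  have cD : Differentiable ℝ c := hc.differentiable (by simp)
  have dD : Differentiable ℝ (fun v => (d v : ℂ)) := cdd.differentiable (by simp)
  have H : ∀ p : ℂ × ℂ, ∃ X Y, HW (fun q => (smae a d b c q : ℂ)) X
      ((a p.2 : ℂ) * p.1 + 2 * ((starRingEnd ℂ) (b p.2) * (starRingEnd ℂ) p.1)
        + (starRingEnd ℂ) (c p.2)) Y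
      ((a p.2 : ℂ) * (starRingEnd ℂ) (deriv h p.2) * (p.1 * (starRingEnd ℂ) p.1)
        + (starRingEnd ℂ) (deriv b p.2) * ((starRingEnd ℂ) p.1 * (starRingEnd ℂ) p.1)
        + (a p.2 : ℂ) * (starRingEnd ℂ) (f p.2) * p.1
        + (starRingEnd ℂ) (wDeriv c p.2) * (starRingEnd ℂ) p.1
        + wBarDeriv (fun v => (d v : ℂ)) p.2) p := by
    intro p
    rw [hu]
    have t1 := (hA p).mul ((hz p).mul (hzb p))
    have t2 := (HW.holo p hb).mul ((hz p).mul (hz p))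
    have t3 := (HW.lift p (cD p.2)).mul (hz p)
    have t4 := HW.lift p (dD p.2)
    refine ⟨_, _, (((t1.add ((t2.add t2.conj).add (t3.add t3.conj))).add t4)).congr rfl ?_ rfl ?_⟩
    · simp; ring
    · simp [hceq]; ring
  have Hzb : (pzBarDeriv fun q => (smae a d b c q : ℂ)) = fun p =>
      (a p.2 : ℂ) * p.1 + 2 * ((starRingEnd ℂ) (b p.2) * (starRingEnd ℂ) p.1)
        + (starRingEnd ℂ) (c p.2) := by
    funext p; obtain ⟨X, Y, hp⟩ := H p; exact hp.pzb
  have Hwb : (pwBarDeriv fun q => (smae a d b c q : ℂ)) = fun p =>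
      (a p.2 : ℂ) * (starRingEnd ℂ) (deriv h p.2) * (p.1 * (starRingEnd ℂ) p.1)
        + (starRingEnd ℂ) (deriv b p.2) * ((starRingEnd ℂ) p.1 * (starRingEnd ℂ) p.1)
        + (a p.2 : ℂ) * (starRingEnd ℂ) (f p.2) * p.1
        + (starRingEnd ℂ) (wDeriv c p.2) * (starRingEnd ℂ) p.1
        + wBarDeriv (fun v => (d v : ℂ)) p.2 := by
    funext p; obtain ⟨X, Y, hp⟩ := H p; exact hp.pwb
  have hcc : ∀ p : ℂ × ℂ, wBarDeriv (wDeriv c) p.2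
      = (a p.2 : ℂ) * deriv h p.2 * (starRingEnd ℂ) (f p.2) := by
    intro p
    rw [wirt_symm hc]
    have e1 := (HW.lift p (wBarDeriv_diff hc p.2)).pw
    rw [← e1]
    simp only [hceq]
    rw [((hA p).mul (HW.holo p hf).conj).pw]
    simp; ring
  have key : ∀ p : ℂ × ℂ, complexHessian (smae a d b c) p =
      !![(a p.2 : ℂ), (a p.2 : ℂ) * (starRingEnd ℂ) (deriv h p.2 * p.1 + f p.2);
        (a p.2 : ℂ) * (deriv h p.2 * p.1 + f p.2),
        (a p.2 : ℂ) * ((deriv h p.2 * p.1 + f p.2)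
          * (starRingEnd ℂ) (deriv h p.2 * p.1 + f p.2)) + (a p.2 : ℂ)⁻¹] := by
    intro p
    have s1 := (((hA p).mul (hz p)).add ((HW.const 2 p).mul ((HW.holo p hb).conj.mul (hzb p)))).add
      (HW.lift p (cD p.2)).conj
    have s2 := (((((hA p).mul (HW.holo p hh').conj).mul ((hz p).mul (hzb p))).add
      ((HW.holo p hb').conj.mul ((hzb p).mul (hzb p)))).add
      (((hA p).mul (HW.holo p hf).conj).mul (hz p))).add
      ((HW.lift p (wDeriv_diff hc p.2)).conj.mul (hzb p)) |>.add
      (HW.lift p (wBarDeriv_diff cdd p.2))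
    unfold complexHessian
    rw [Hzb, Hwb, s1.pz, s1.pw, s2.pz, s2.pw, hcc, hceq]
    have hdd := hdeq p.2
    unfold wBarWDeriv at hdd
    rw [hdd]
    push_cast
    rw [← Complex.mul_conj]
    congr 1
    ext i j
    fin_cases i <;> fin_cases j <;> simp <;> ring
  intro p
  refine ⟨?_, ?_⟩
  · unfold StrictPSHAt
    rw [key, hE]
    exact posDef_aux _ _ (Complex.exp_ne_zero _)
  · unfold MAdet
    rw [key, Matrix.det_fin_two]
    have := hapos p.2
    simp
    field_simp
    ring
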